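/- Let G be a connected graph on n ≥ 3 vertices and |G⟩ the corresponding graph state with stabilizer S; let S_d be the subgroup of S generated by all elements of S of weight at most d, and let η(|G⟩) be the minimal d such that S_d = S. Then η(|G⟩) ≥ 3. Consequently, no fully entangled n-qubit graph state (n ≥ 3) is the non-degenerate ground state of a two-body Hamiltonian on n qubits. -/

import Mathlib

open Matrix BigOperators
open scoped Classical

noncomputable section

/-- The state space of `n` qubits, `(ℂ²)^{⊗n}`, realized as functions from bit strings to `ℂ`. -/
abbrev QState (n : ℕ) : Type := (Fin n → Fin 2) → ℂ

/-- Operators on `n` qubits. -/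
abbrev QOp (n : ℕ) : Type := Matrix (Fin n → Fin 2) (Fin n → Fin 2) ℂ

/-- The single qubit Pauli matrices: `0 ↦ σ₀ = I`, `1 ↦ σ_x`, `2 ↦ σ_y`, `3 ↦ σ_z`. -/
def pauli1 (k : Fin 4) : Matrix (Fin 2) (Fin 2) ℂ :=
  if k = 0 then 1
  else if k = 1 then !![0, 1; 1, 0]
  else if k = 2 then !![0, -Complex.I; Complex.I, 0]
  else !![1, 0; 0, -1]

/-- The `n`-qubit Pauli operator `σ_{f 0} ⊗ σ_{f 1} ⊗ ⋯ ⊗ σ_{f (n-1)}`. -/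
def pauliOp {n : ℕ} (f : Fin n → Fin 4) : QOp n :=
  Matrix.of fun v w => ∏ i, pauli1 (f i) (v i) (w i)

/-- The support of a Pauli operator: the qubits on which it acts nontrivially. -/
def pSupport {n : ℕ} (f : Fin n → Fin 4) : Finset (Fin n) :=
  Finset.univ.filter fun i => f i ≠ 0

/-- The weight of a Pauli operator: the number of qubits on which it acts nontrivially. -/
def pWeight {n : ℕ} (f : Fin n → Fin 4) : ℕ := (pSupport f).card

/-- `g` is the signed Pauli operator `±σ_f`. -/
def IsSignedPauli {n : ℕ} (g : QOp n) (f : Fin n → Fin 4) : Prop :=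
  g = pauliOp f ∨ g = -pauliOp f

/-- The squared norm `∑_v |ψ_v|²` of an `n`-qubit state. -/
def qNormSq {n : ℕ} (ψ : QState n) : ℝ := ∑ v, Complex.normSq (ψ v)

/-- The inner product `⟨φ|ψ⟩` (antilinear in the first argument). -/
def qInner {n : ℕ} (φ ψ : QState n) : ℂ := ∑ v, starRingEnd ℂ (φ v) * ψ v

/-- The graph state correlation operator `K_a = σ_x^(a) ∏_{b ∈ N(a)} σ_z^(b)`. -/
def Kop {n : ℕ} (G : SimpleGraph (Fin n)) [DecidableRel G.Adj] (a : Fin n) : QOp n :=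
  pauliOp fun b => if b = a then 1 else if G.Adj a b then 3 else 0

/-- `ψ` is the graph state `|G⟩`: a unit vector fixed by all correlation operators `K_a`. -/
def IsGraphState {n : ℕ} (G : SimpleGraph (Fin n)) [DecidableRel G.Adj] (ψ : QState n) : Prop :=
  qNormSq ψ = 1 ∧ ∀ a : Fin n, Kop G a *ᵥ ψ = ψ

/-- The stabilizer of `ψ`: all signed Pauli operators `g = ±σ` with `g ψ = ψ`. -/
def stab {n : ℕ} (ψ : QState n) : Set (QOp n) :=
  {g | (∃ f, IsSignedPauli g f) ∧ g *ᵥ ψ = ψ}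

/-- The stabilizer elements of weight at most `d`. -/
def stabW {n : ℕ} (ψ : QState n) (d : ℕ) : Set (QOp n) :=
  {g | g ∈ stab ψ ∧ ∃ f, IsSignedPauli g f ∧ pWeight f ≤ d}

/-- `S_d`: the subgroup of the stabilizer generated by all elements of weight at most `d`,
as a set of operators.  (Since the stabilizer is a finite group, the generated submonoid
coincides with the generated subgroup.) -/
def SdSet {n : ℕ} (ψ : QState n) (d : ℕ) : Set (QOp n) :=
  (Submonoid.closure (stabW ψ d) : Set (QOp n))

/-- `δ(|ψ⟩)`: the minimal weight of a nonidentity element of the stabilizer of `ψ`. -/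
def deltaG {n : ℕ} (ψ : QState n) : ℕ :=
  sInf {d | ∃ g ∈ stab ψ, g ≠ 1 ∧ ∃ f, IsSignedPauli g f ∧ pWeight f = d}

/-- `η(|ψ⟩)`: the minimal `d` such that `S_d = S`. -/
def etaG {n : ℕ} (ψ : QState n) : ℕ :=
  sInf {d | stab ψ ⊆ SdSet ψ d}

/-- A `d`-body Hamiltonian on `n` qubits: a real linear combination of Pauli operators
of weight at most `d`. -/
def IsDBody {n : ℕ} (d : ℕ) (H : QOp n) : Prop :=
  ∃ h : (Fin n → Fin 4) → ℝ, (∀ f, d < pWeight f → h f = 0) ∧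
    H = ∑ f : Fin n → Fin 4, (h f : ℂ) • pauliOp f

/-- A Hamiltonian is nontrivial if it is nonzero and not a multiple of the identity. -/
def NontrivialHam {n : ℕ} (H : QOp n) : Prop :=
  H ≠ 0 ∧ ∀ c : ℂ, H ≠ c • (1 : QOp n)

/-- `φ` is an eigenvector of `H` with (real) eigenvalue `E`. -/
def IsEigenpair {n : ℕ} (H : QOp n) (E : ℝ) (φ : QState n) : Prop :=
  φ ≠ 0 ∧ H *ᵥ φ = (E : ℂ) • φ

/-- `ψ` is a ground state of `H` with ground energy `E`: an eigenvector for the smallest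
eigenvalue `E` of `H`. -/
def IsGroundStateE {n : ℕ} (H : QOp n) (ψ : QState n) (E : ℝ) : Prop :=
  IsEigenpair H E ψ ∧ ∀ E' φ, IsEigenpair H E' φ → E ≤ E'

/-- `ψ` is a ground state of `H`. -/
def IsGroundState {n : ℕ} (H : QOp n) (ψ : QState n) : Prop :=
  ∃ E, IsGroundStateE H ψ E

/-- The dimension of the eigenspace of `H` for the eigenvalue `E` (the multiplicity of `E`). -/
def eigDim {n : ℕ} (H : QOp n) (E : ℝ) : ℕ :=
  Module.finrank ℂ (Module.End.eigenspace (Matrix.mulVecLin H) ((E : ℂ)))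


/-- The sign relating the two products of single qubit Pauli matrices. -/
def commSign (k l : Fin 4) : ℂ := if k = 0 ∨ l = 0 ∨ k = l then 1 else -1

/-- The sign relating the two products of `n`-qubit Pauli operators. -/
def pauliSign {n : ℕ} (f g : Fin n → Fin 4) : ℂ := ∏ i, commSign (f i) (g i)

theorem pauli1_mul_comm (k l : Fin 4) :
    pauli1 k * pauli1 l = commSign k l • (pauli1 l * pauli1 k) := by
  fin_cases k <;> fin_cases l <;> ext i j <;> fin_cases i <;> fin_cases j <;>
    simp [pauli1, commSign, Matrix.mul_apply]

theorem pauli1_mul_self (k : Fin 4) : pauli1 k * pauli1 k = 1 := by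
  fin_cases k <;> ext i j <;> fin_cases i <;> fin_cases j <;>
    simp [pauli1, Matrix.mul_apply]

theorem star_pauli1_apply (k : Fin 4) (i j : Fin 2) : star (pauli1 k i j) = pauli1 k j i := by
  fin_cases k <;> fin_cases i <;> fin_cases j <;> simp [pauli1]

theorem pauliOp_mul_apply {n : ℕ} (f g : Fin n → Fin 4) (v w : Fin n → Fin 2) :
    (pauliOp f * pauliOp g) v w = ∏ i, (pauli1 (f i) * pauli1 (g i)) (v i) (w i) := by
  simp only [Matrix.mul_apply, pauliOp, Matrix.of_apply, ← Finset.prod_mul_distrib]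
  rw [Finset.prod_univ_sum, Fintype.piFinset_univ]

theorem pauliOp_mul_comm {n : ℕ} (f g : Fin n → Fin 4) :
    pauliOp f * pauliOp g = pauliSign f g • (pauliOp g * pauliOp f) := by
  ext v w
  rw [Matrix.smul_apply, pauliOp_mul_apply, pauliOp_mul_apply, pauliSign, smul_eq_mul,
    ← Finset.prod_mul_distrib]
  refine Finset.prod_congr rfl fun i _ => ?_
  rw [pauli1_mul_comm, Matrix.smul_apply, smul_eq_mul]

theorem pauliOp_mul_self {n : ℕ} (f : Fin n → Fin 4) : pauliOp f * pauliOp f = 1 := by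
  ext v w
  simp only [pauliOp_mul_apply, pauli1_mul_self, Matrix.one_apply, Finset.prod_ite_zero,
    Finset.prod_const_one, Finset.mem_univ, true_imp_iff, funext_iff]

theorem pauliOp_isHermitian {n : ℕ} (f : Fin n → Fin 4) : (pauliOp f).IsHermitian := by
  ext v w
  simp only [Matrix.conjTranspose_apply, pauliOp, Matrix.of_apply, star_prod, star_pauli1_apply]

theorem pauliSign_eq_one_or {n : ℕ} (f g : Fin n → Fin 4) :
    pauliSign f g = 1 ∨ pauliSign f g = -1 := by
  unfold pauliSign
  refine Finset.prod_induction _ (fun x : ℂ => x = 1 ∨ x = -1) ?_ (Or.inl rfl) ?_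
  · rintro a b (rfl | rfl) (rfl | rfl) <;> simp
  · intro i _
    unfold commSign
    split_ifs <;> simp

/-- The label of the correlation operator `K_a`. -/
def corrLabel {n : ℕ} (G : SimpleGraph (Fin n)) (a : Fin n) : Fin n → Fin 4 :=
  fun b => if b = a then 1 else if G.Adj a b then 3 else 0

theorem Kop_eq_pauliOp {n : ℕ} (G : SimpleGraph (Fin n)) [DecidableRel G.Adj] (a : Fin n) :
    Kop G a = pauliOp (corrLabel G a) := by
  unfold Kop corrLabel
  congr!

/-- The label of the product of `σ_z` over all vertices with at least two neighbors. -/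
def branchLabel {n : ℕ} (G : SimpleGraph (Fin n)) : Fin n → Fin 4 :=
  fun v => if (G.neighborSet v).Subsingleton then 0 else 3

theorem pauliSign_eq_mul {n : ℕ} {f : Fin n → Fin 4} {p q : Fin n} (hpq : p ≠ q)
    (hf : ∀ i, i ≠ p → i ≠ q → f i = 0) (g : Fin n → Fin 4) :
    pauliSign f g = commSign (f p) (g p) * commSign (f q) (g q) :=
  Fintype.prod_eq_mul p q hpq fun i hi => by simp [commSign, hf i hi.1 hi.2]

theorem commSign_three (k : Fin 4) : commSign k 3 = if k = 0 ∨ k = 3 then 1 else -1 := by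
  simp [commSign]

theorem commSign_zero (k : Fin 4) : commSign k 0 = 1 := by
  simp [commSign]

theorem neighborSet_subsingleton_of_pauliSign {n : ℕ} (G : SimpleGraph (Fin n))
    {f : Fin n → Fin 4} {p q : Fin n} (hpq : p ≠ q) (hf : ∀ i, i ≠ p → i ≠ q → f i = 0)
    (hcomm : ∀ a, pauliSign f (corrLabel G a) = 1)
    (hp : f p = 0 ∨ f p = 3) (hq : ¬ (f q = 0 ∨ f q = 3)) :
    (G.neighborSet q).Subsingleton := by
  have key : ∀ a, G.Adj q a → a = p := by
    intro a ha
    by_contra hap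
    have h := hcomm a
    rw [pauliSign_eq_mul hpq hf] at h
    have h2 : commSign (f p) (corrLabel G a p) = 1 := by
      unfold corrLabel
      rw [if_neg (Ne.symm hap)]
      split_ifs
      · rw [commSign_three, if_pos hp]
      · exact commSign_zero _
    have h3 : commSign (f q) (corrLabel G a q) = -1 := by
      unfold corrLabel
      rw [if_neg ha.ne, if_pos ha.symm, commSign_three, if_neg hq]
    rw [h2, h3] at h
    norm_num at h
  intro a ha b hb
  rw [key a ha, key b hb]

theorem neighborSet_subsingleton_of_twin {n : ℕ} (G : SimpleGraph (Fin n)) {p q : Fin n}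
    (h : ∀ a, a ≠ p → a ≠ q → (G.Adj a p ↔ G.Adj a q)) :
    (G.neighborSet p).Subsingleton → (G.neighborSet q).Subsingleton := by
  intro hp a ha b hb
  simp only [Set.Subsingleton, SimpleGraph.mem_neighborSet] at hp ha hb
  have := @hp a
  have := @hp b
  have := @hp q
  have := h a
  have := h b
  have := G.adj_comm
  have := G.irrefl (v := q)
  grind

/-- A Pauli operator of weight at most two which commutes with every correlation operator
commutes with the product of `σ_z` over the vertices with at least two neighbors. -/
theorem pauliSign_branchLabel {n : ℕ} (hn : 3 ≤ n) (G : SimpleGraph (Fin n))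
    {f : Fin n → Fin 4} (hw : pWeight f ≤ 2) (hcomm : ∀ a, pauliSign f (corrLabel G a) = 1) :
    pauliSign f (branchLabel G) = 1 := by
  obtain ⟨s, hs, hcard⟩ := Finset.exists_superset_card_eq (s := pSupport f) (n := 2) hw
    (by simp; omega)
  obtain ⟨p, q, hpq, rfl⟩ := Finset.card_eq_two.mp hcard
  have hf : ∀ i, i ≠ p → i ≠ q → f i = 0 := by
    intro i hip hiq
    by_contra h
    have := hs (show i ∈ pSupport f by simp [pSupport, h])
    simp [hip, hiq] at this
  have hf' : ∀ i, i ≠ q → i ≠ p → f i = 0 := fun i h h' => hf i h' h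
  rw [pauliSign_eq_mul hpq hf]
  by_cases hp : f p = 0 ∨ f p = 3 <;> by_cases hq : f q = 0 ∨ f q = 3
  · unfold branchLabel
    split_ifs <;> simp [commSign_zero, commSign_three, hp, hq]
  · have := neighborSet_subsingleton_of_pauliSign G hpq hf hcomm hp hq
    unfold branchLabel
    split_ifs <;> simp [commSign_zero, commSign_three, hp]
  · have := neighborSet_subsingleton_of_pauliSign G hpq.symm hf' hcomm hq hp
    unfold branchLabel
    split_ifs <;> simp [commSign_zero, commSign_three, hq]
  · have htwin : ∀ a, a ≠ p → a ≠ q → (G.Adj a p ↔ G.Adj a q) := by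
      intro a hap haq
      have h := hcomm a
      rw [pauliSign_eq_mul hpq hf] at h
      simp only [corrLabel, if_neg hap.symm, if_neg haq.symm] at h
      by_cases h1 : G.Adj a p <;> by_cases h2 : G.Adj a q <;>
        simp only [h1, h2, if_true, if_false, commSign_zero, commSign_three, hp, hq] at h ⊢ <;>
        norm_num at h
    have h1 := neighborSet_subsingleton_of_twin G htwin
    have h2 := neighborSet_subsingleton_of_twin G fun a h h' => (htwin a h' h).symm
    unfold branchLabel
    simp only [show (G.neighborSet p).Subsingleton ↔ (G.neighborSet q).Subsingleton from ⟨h1, h2⟩]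
    split_ifs <;> simp [commSign_zero, commSign_three, hp, hq]

theorem exists_not_neighborSet_subsingleton {n : ℕ} (hn : 3 ≤ n) {G : SimpleGraph (Fin n)}
    (hG : G.Connected) : ∃ a, ¬ (G.neighborSet a).Subsingleton := by
  by_contra! h
  have hdeg : ∀ v, G.degree v ≤ 1 := by
    intro v
    rw [← G.card_neighborFinset_eq_degree, Finset.card_le_one]
    intro a ha b hb
    exact h v (by simpa using ha) (by simpa using hb)
  have h1 := hG.card_vert_le_card_edgeSet_add_one
  have h2 := G.sum_degrees_eq_twice_card_edges
  have h3 : ∑ v, G.degree v ≤ n := by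
    simpa using Finset.sum_le_sum fun v (_ : v ∈ Finset.univ) => hdeg v
  rw [Nat.card_eq_fintype_card, Nat.card_eq_fintype_card, Fintype.card_fin,
    ← SimpleGraph.edgeFinset_card] at h1
  omega

theorem pauliSign_corrLabel_branchLabel {n : ℕ} (G : SimpleGraph (Fin n)) {a : Fin n}
    (ha : ¬ (G.neighborSet a).Subsingleton) :
    pauliSign (corrLabel G a) (branchLabel G) = -1 := by
  unfold pauliSign
  rw [Fintype.prod_eq_single a]
  · simp [corrLabel, branchLabel, ha, commSign]
  · intro b hb
    unfold corrLabel branchLabel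
    rw [if_neg hb]
    split_ifs <;> simp [commSign]

theorem pauliOp_comm_of_sign {n : ℕ} {f g : Fin n → Fin 4} (h : pauliSign f g = 1) :
    pauliOp f * pauliOp g = pauliOp g * pauliOp f := by
  rw [pauliOp_mul_comm, h, one_smul]

theorem pauliOp_anticomm_of_sign {n : ℕ} {f g : Fin n → Fin 4} (h : pauliSign f g = -1) :
    pauliOp f * pauliOp g = -(pauliOp g * pauliOp f) := by
  rw [pauliOp_mul_comm, h, neg_one_smul]

theorem IsGraphState.ne_zero {n : ℕ} {G : SimpleGraph (Fin n)} [DecidableRel G.Adj]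
    {ψ : QState n} (hψ : IsGraphState G ψ) : ψ ≠ 0 := by
  rintro rfl
  simpa [qNormSq] using hψ.1

theorem IsGraphState.corr_mulVec {n : ℕ} {G : SimpleGraph (Fin n)} [DecidableRel G.Adj]
    {ψ : QState n} (hψ : IsGraphState G ψ) (a : Fin n) :
    pauliOp (corrLabel G a) *ᵥ ψ = ψ := by
  rw [← Kop_eq_pauliOp]
  exact hψ.2 a

theorem pauliOp_mulVec_ne_zero {n : ℕ} (f : Fin n → Fin 4) {ψ : QState n} (hψ : ψ ≠ 0) :
    pauliOp f *ᵥ ψ ≠ 0 := by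
  intro h
  apply hψ
  rw [← Matrix.one_mulVec ψ, ← pauliOp_mul_self f, ← Matrix.mulVec_mulVec, h, Matrix.mulVec_zero]

/-- The image of a graph state under the `σ_z` operator of the branching vertices is an
eigenvector of `K_a` with eigenvalue `-1` for every branching vertex `a`. -/
theorem IsGraphState.corr_mulVec_branch {n : ℕ} {G : SimpleGraph (Fin n)} [DecidableRel G.Adj]
    {ψ : QState n} (hψ : IsGraphState G ψ) {a : Fin n}
    (ha : ¬ (G.neighborSet a).Subsingleton) :
    pauliOp (corrLabel G a) *ᵥ (pauliOp (branchLabel G) *ᵥ ψ) =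
      -(pauliOp (branchLabel G) *ᵥ ψ) := by
  rw [Matrix.mulVec_mulVec, pauliOp_anticomm_of_sign (pauliSign_corrLabel_branchLabel G ha),
    Matrix.neg_mulVec, ← Matrix.mulVec_mulVec, hψ.corr_mulVec]

/-- The operators of `S_2` commute with the `σ_z` operator of the branching vertices. -/
theorem IsGraphState.commute_branch {n : ℕ} (hn : 3 ≤ n) {G : SimpleGraph (Fin n)}
    [DecidableRel G.Adj] {ψ : QState n} (hψ : IsGraphState G ψ) {d : ℕ} (hd : d ≤ 2)
    {g : QOp n} (hg : g ∈ SdSet ψ d) :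
    pauliOp (branchLabel G) * g = g * pauliOp (branchLabel G) := by
  suffices h : Submonoid.closure (stabW ψ d) ≤
      Submonoid.centralizer {pauliOp (branchLabel G)} from
    Submonoid.mem_centralizer_iff.mp (h hg) _ rfl
  rw [Submonoid.closure_le]
  rintro g ⟨⟨-, hgψ⟩, f, hgf, hw⟩
  have hcomm : ∀ a, pauliSign f (corrLabel G a) = 1 := by
    intro a
    refine (pauliSign_eq_one_or f (corrLabel G a)).resolve_right fun hneg => ?_
    have hanti := pauliOp_anticomm_of_sign hneg
    have hanti' : g * pauliOp (corrLabel G a) = -(pauliOp (corrLabel G a) * g) := by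
      rcases hgf with rfl | rfl <;> simp [hanti]
    have h := congrArg (· *ᵥ ψ) hanti'
    simp only [Matrix.neg_mulVec, ← Matrix.mulVec_mulVec, hgψ, hψ.corr_mulVec] at h
    exact hψ.ne_zero (self_eq_neg.mp h)
  have hc := pauliOp_comm_of_sign (pauliSign_branchLabel hn G (hw.trans hd) hcomm)
  refine Submonoid.mem_centralizer_iff.mpr ?_
  rintro _ rfl
  rcases hgf with rfl | rfl <;> simp [hc]

theorem IsGraphState.three_le_etaG {n : ℕ} (hn : 3 ≤ n) {G : SimpleGraph (Fin n)}
    [DecidableRel G.Adj] (hG : G.Connected) {ψ : QState n} (hψ : IsGraphState G ψ) :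
    3 ≤ etaG ψ := by
  have hmem : etaG ψ ∈ {d | stab ψ ⊆ SdSet ψ d} := by
    refine Nat.sInf_mem ⟨n, fun g hg => Submonoid.subset_closure ⟨hg, ?_⟩⟩
    obtain ⟨f, hf⟩ := hg.1
    exact ⟨f, hf, by simpa [pWeight] using Finset.card_le_univ (pSupport f)⟩
  by_contra hlt
  obtain ⟨a, ha⟩ := exists_not_neighborSet_subsingleton hn hG
  have hK : pauliOp (corrLabel G a) ∈ stab ψ := ⟨⟨_, Or.inl rfl⟩, hψ.corr_mulVec a⟩
  have hc := hψ.commute_branch hn (by omega) (hmem hK)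
  have h := hψ.corr_mulVec_branch ha
  rw [Matrix.mulVec_mulVec, ← hc, ← Matrix.mulVec_mulVec, hψ.corr_mulVec] at h
  exact pauliOp_mulVec_ne_zero _ hψ.ne_zero (self_eq_neg.mp h)

theorem star_mulVec_dotProduct_of_isHermitian {ι : Type*} [Fintype ι] {A : Matrix ι ι ℂ}
    (hA : A.IsHermitian) (v w : ι → ℂ) : star (A *ᵥ v) ⬝ᵥ w = star v ⬝ᵥ (A *ᵥ w) := by
  rw [Matrix.star_mulVec, hA.eq, Matrix.dotProduct_mulVec]

/-- The expectation value of a Pauli operator of weight at most two is the same in a graph state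
and in its image under the `σ_z` operator of the branching vertices. -/
theorem IsGraphState.expectation_branch {n : ℕ} (hn : 3 ≤ n) {G : SimpleGraph (Fin n)}
    [DecidableRel G.Adj] {ψ : QState n} (hψ : IsGraphState G ψ)
    {f : Fin n → Fin 4} (hw : pWeight f ≤ 2) :
    star (pauliOp (branchLabel G) *ᵥ ψ) ⬝ᵥ (pauliOp f *ᵥ (pauliOp (branchLabel G) *ᵥ ψ)) =
      star ψ ⬝ᵥ (pauliOp f *ᵥ ψ) := by
  rw [star_mulVec_dotProduct_of_isHermitian (pauliOp_isHermitian _), Matrix.mulVec_mulVec,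
    Matrix.mulVec_mulVec, Matrix.mul_assoc]
  rcases pauliSign_eq_one_or f (branchLabel G) with h | h
  · rw [pauliOp_comm_of_sign h, ← Matrix.mul_assoc, pauliOp_mul_self, Matrix.one_mul]
  · obtain ⟨a, ha⟩ : ∃ a, pauliSign f (corrLabel G a) ≠ 1 := by
      by_contra! hcomm
      have := pauliSign_branchLabel hn G hw hcomm
      rw [this] at h
      norm_num at h
    have hanti := pauliOp_anticomm_of_sign ((pauliSign_eq_one_or _ _).resolve_left ha)
    have hzero : star ψ ⬝ᵥ (pauliOp f *ᵥ ψ) = 0 := by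
      have key : star ψ ⬝ᵥ (pauliOp f *ᵥ ψ) = -(star ψ ⬝ᵥ (pauliOp f *ᵥ ψ)) := by
        conv_lhs => rw [← hψ.corr_mulVec a]
        rw [star_mulVec_dotProduct_of_isHermitian (pauliOp_isHermitian _),
          Matrix.mulVec_mulVec (M := pauliOp f), hanti, Matrix.neg_mulVec, Matrix.mulVec_neg,
          ← Matrix.mulVec_mulVec, Matrix.mulVec_mulVec, pauliOp_mul_self, Matrix.one_mulVec,
          dotProduct_neg]
      exact self_eq_neg.mp key
    rw [pauliOp_anticomm_of_sign h, Matrix.mul_neg, ← Matrix.mul_assoc, pauliOp_mul_self,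
      Matrix.one_mul, Matrix.neg_mulVec, dotProduct_neg, hzero, neg_zero]

theorem IsDBody.isHermitian {n d : ℕ} {H : QOp n} (hH : IsDBody d H) : H.IsHermitian := by
  obtain ⟨h, -, rfl⟩ := hH
  unfold Matrix.IsHermitian
  rw [Matrix.conjTranspose_sum]
  refine Finset.sum_congr rfl fun f _ => ?_
  rw [Matrix.conjTranspose_smul, (pauliOp_isHermitian f).eq]
  simp

open scoped ComplexOrder in
/-- A Hermitian operator minus its smallest eigenvalue is positive semidefinite. -/
theorem posSemidef_sub_of_le_eigenvalues {n : ℕ} {H : QOp n} (hH : H.IsHermitian) {E : ℝ}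
    (hE : ∀ E' φ, IsEigenpair H E' φ → E ≤ E') : (H - (E : ℂ) • (1 : QOp n)).PosSemidef := by
  have hHerm : (H - (E : ℂ) • (1 : QOp n)).IsHermitian := by
    refine hH.sub ?_
    unfold Matrix.IsHermitian
    simp [Matrix.conjTranspose_smul]
  rw [hHerm.posSemidef_iff_eigenvalues_nonneg]
  intro i
  have hv := hHerm.mulVec_eigenvectorBasis i
  have hne := hHerm.eigenvectorBasis.orthonormal.ne_zero i
  have := hE (E + hHerm.eigenvalues i) (hHerm.eigenvectorBasis i).ofLp
    ⟨fun h => hne (by ext j; exact congrFun h j), by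
      rw [Matrix.sub_mulVec, Matrix.smul_mulVec, Matrix.one_mulVec, sub_eq_iff_eq_add] at hv
      rw [hv]
      ext j
      simp
      ring⟩
  simpa using this

open scoped ComplexOrder in
theorem IsGraphState.eigDim_ne_one {n : ℕ} (hn : 3 ≤ n) {G : SimpleGraph (Fin n)}
    [DecidableRel G.Adj] (hG : G.Connected) {ψ : QState n} (hψ : IsGraphState G ψ)
    {H : QOp n} {E : ℝ} (hH : IsDBody 2 H) (hground : IsGroundStateE H ψ E) :
    eigDim H E ≠ 1 := by
  have hpos := posSemidef_sub_of_le_eigenvalues hH.isHermitian hground.2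
  set φ := pauliOp (branchLabel G) *ᵥ ψ with hφ
  have hexp : star φ ⬝ᵥ (H *ᵥ φ) = star ψ ⬝ᵥ (H *ᵥ ψ) := by
    obtain ⟨h, hh, rfl⟩ := hH
    simp only [Matrix.sum_mulVec, dotProduct_sum, Matrix.smul_mulVec, dotProduct_smul]
    refine Finset.sum_congr rfl fun f _ => ?_
    by_cases hw : pWeight f ≤ 2
    · rw [hφ, hψ.expectation_branch hn hw]
    · simp [hh f (not_le.mp hw)]
  have hnorm : star φ ⬝ᵥ φ = star ψ ⬝ᵥ ψ := by
    rw [hφ, star_mulVec_dotProduct_of_isHermitian (pauliOp_isHermitian _), Matrix.mulVec_mulVec,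
      pauliOp_mul_self, Matrix.one_mulVec]
  have hφE : H *ᵥ φ = (E : ℂ) • φ := by
    have h := (hpos.dotProduct_mulVec_zero_iff φ).mp (by
      rw [Matrix.sub_mulVec, Matrix.smul_mulVec, Matrix.one_mulVec, dotProduct_sub, hexp,
        dotProduct_smul, hnorm, hground.1.2, dotProduct_smul, sub_self])
    rwa [Matrix.sub_mulVec, Matrix.smul_mulVec, Matrix.one_mulVec, sub_eq_zero] at h
  intro hdim
  have hmem : ∀ χ : QState n, H *ᵥ χ = (E : ℂ) • χ →
      χ ∈ Module.End.eigenspace (Matrix.mulVecLin H) (E : ℂ) := fun χ hχ =>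
    Module.End.mem_eigenspace_iff.mpr hχ
  obtain ⟨c, hc⟩ := (finrank_eq_one_iff_of_nonzero' ⟨ψ, hmem ψ hground.1.2⟩
    (by simpa using hψ.ne_zero)).mp hdim ⟨φ, hmem φ hφE⟩
  have hcψ : c • ψ = φ := congrArg Subtype.val hc
  obtain ⟨a, ha⟩ := exists_not_neighborSet_subsingleton hn hG
  have h := hψ.corr_mulVec_branch ha
  rw [← hφ, ← hcψ, Matrix.mulVec_smul, hψ.corr_mulVec, hcψ] at h
  exact pauliOp_mulVec_ne_zero _ hψ.ne_zero (self_eq_neg.mp h)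

/-- for every connected graph `G` on `n ≥ 3` vertices with graph state `|G⟩`
one has `η(|G⟩) ≥ 3`; consequently, no fully entangled `n`-qubit graph state (`n ≥ 3`) is
the non-degenerate ground state of a two-body Hamiltonian on `n` qubits. -/
theorem eta_ge_three_no_two_body_nondegenerate
    {n : ℕ} (hn : 3 ≤ n) (G : SimpleGraph (Fin n)) [DecidableRel G.Adj]
    (hG : G.Connected) (ψ : QState n) (hψ : IsGraphState G ψ) :
    3 ≤ etaG ψ ∧
    ∀ (H : QOp n) (E : ℝ), IsDBody 2 H → IsGroundStateE H ψ E → eigDim H E ≠ 1 := by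
  exact ⟨hψ.three_le_etaG hn hG, fun _ _ hH hground => hψ.eigDim_ne_one hn hG hH hground⟩
end
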